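/- Let G be a 2-connected graph. If G is both K_{1,3}-f-heavy and N-f-heavy, where N (the net) is the triangle with a pendant edge attached at each of its three vertices, then G is Hamiltonian. -/

import Mathlib

open SimpleGraph

/-- `G` contains a cycle of length `k`. -/
def HasCycleLength {V : Type} (G : SimpleGraph V) (k : ℕ) : Prop :=
  ∃ (v : V) (c : G.Walk v v), c.IsCycle ∧ c.length = k

/-- A graph on `n` vertices is pancyclic if it contains cycles of every length from 3 to `n`. -/
def IsPancyclic {V : Type} [Fintype V] (G : SimpleGraph V) : Prop :=
  ∀ k : ℕ, 3 ≤ k → k ≤ Fintype.card V → HasCycleLength G k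

/-- A graph is Hamiltonian if it contains a spanning cycle. -/
def IsHamiltonianGraph {V : Type} (G : SimpleGraph V) : Prop :=
  ∃ (v : V) (c : G.Walk v v), c.IsCycle ∧ ∀ u : V, u ∈ c.support

/-- A graph is 2-connected if it has at least 3 vertices and deleting any single
vertex leaves a connected graph. -/
def TwoConnected {V : Type} [Fintype V] (G : SimpleGraph V) : Prop :=
  3 ≤ Fintype.card V ∧ ∀ v : V, (G.induce {u : V | u ≠ v}).Connected

/-- A (finite) graph is a cycle iff it is connected and 2-regular. -/
def IsCycleGraph {V : Type} [Fintype V] (G : SimpleGraph V) [DecidableRel G.Adj] : Prop :=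
  G.Connected ∧ ∀ v : V, G.degree v = 2

/-- `G` is `R`-f₁-heavy: for every induced copy of `R` in `G` (given by a graph
embedding `f : R ↪g G`) and every pair of vertices at distance 2 in that copy,
one of them has degree at least `(n+1)/2` in `G`. -/
def F1Heavy {V W : Type} [Fintype V] (G : SimpleGraph V) [DecidableRel G.Adj]
    (R : SimpleGraph W) : Prop :=
  ∀ (f : R ↪g G) (a b : W), R.dist a b = 2 →
    Fintype.card V + 1 ≤ 2 * max (G.degree (f a)) (G.degree (f b))

/-- `G` is `R`-f-heavy: as above but with degree at least `n/2`. -/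
def FHeavy {V W : Type} [Fintype V] (G : SimpleGraph V) [DecidableRel G.Adj]
    (R : SimpleGraph W) : Prop :=
  ∀ (f : R ↪g G) (a b : W), R.dist a b = 2 →
    Fintype.card V ≤ 2 * max (G.degree (f a)) (G.degree (f b))

/-- `G` is `R`-free: no induced subgraph of `G` is isomorphic to `R`. -/
def RFree {V W : Type} (G : SimpleGraph V) (R : SimpleGraph W) : Prop :=
  IsEmpty (R ↪g G)

/-- The claw `K_{1,3}`: vertex `0` is the center, adjacent to `1`, `2`, `3`. -/
def claw : SimpleGraph (Fin 4) := SimpleGraph.fromRel (fun a _ => a = 0)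

/-- `Z_i`: the path `0 1 2 ... (i+2)` together with the chord `{0,2}`,
i.e. a triangle `0 1 2` with a path of `i` edges attached at vertex `2`. -/
def Zgraph (i : ℕ) : SimpleGraph (Fin (i + 3)) :=
  SimpleGraph.fromRel (fun a b => b.val = a.val + 1 ∨ (a.val = 0 ∧ b.val = 2))

/-- The net `N`: triangle `0 1 2` with pendant edges `0-3`, `1-4`, `2-5`. -/
def netGraph : SimpleGraph (Fin 6) :=
  SimpleGraph.fromRel (fun a b =>
    (a.val = 0 ∧ b.val = 1) ∨ (a.val = 1 ∧ b.val = 2) ∨ (a.val = 0 ∧ b.val = 2) ∨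
    (a.val = 0 ∧ b.val = 3) ∨ (a.val = 1 ∧ b.val = 4) ∨ (a.val = 2 ∧ b.val = 5))

/-- The wounded `W`: triangle `0 1 2` with a pendant edge `0-3` and a pendant
path `1-4-5` of two edges. -/
def woundedGraph : SimpleGraph (Fin 6) :=
  SimpleGraph.fromRel (fun a b =>
    (a.val = 0 ∧ b.val = 1) ∨ (a.val = 1 ∧ b.val = 2) ∨ (a.val = 0 ∧ b.val = 2) ∨
    (a.val = 0 ∧ b.val = 3) ∨ (a.val = 1 ∧ b.val = 4) ∨ (a.val = 4 ∧ b.val = 5))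

section helper
variable {V : Type} [DecidableEq V]

/-- `PathOn A S a b`: the graph `A` has a path from `a` to `b` with vertex set exactly `S`. -/
inductive PathOn (A : SimpleGraph V) : Finset V → V → V → Prop
  | single (a : V) : PathOn A {a} a a
  | cons {S : Finset V} {a b c : V} : A.Adj a b → a ∉ S → PathOn A S b c →
      PathOn A (insert a S) a c

/-- `Lk A I p q`: a path from `p` to `q` whose set of inner vertices is `I`. -/
inductive Lk (A : SimpleGraph V) : Finset V → V → V → Prop
  | nil {p q : V} : A.Adj p q → Lk A ∅ p q
  | cons {I : Finset V} {p x q : V} : A.Adj p x → x ∉ I → Lk A I x q → Lk A (insert x I) p q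

/-- `S` is the vertex set of a cycle. -/
def Cyc (A : SimpleGraph V) (S : Finset V) : Prop :=
  3 ≤ S.card ∧ ∃ a b, A.Adj a b ∧ PathOn A S a b

/-- Two disjoint paths `d`–`a` and `b`–`c` that together span `D`. -/
def Two (A : SimpleGraph V) (D : Finset V) (d a b c : V) : Prop :=
  ∃ S T : Finset V, (∀ z ∈ S, z ∉ T) ∧ S ∪ T = D ∧ PathOn A S d a ∧ PathOn A T b c

namespace PathOn
variable {A B : SimpleGraph V} {S T : Finset V} {a b c d : V}

theorem left_mem (h : PathOn A S a b) : a ∈ S := by cases h <;> simp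
theorem right_mem (h : PathOn A S a b) : b ∈ S := by
  induction h with
  | single => simp
  | cons _ _ _ ih => simp [ih]
theorem of_eq (h : PathOn A S a b) (e : S = T) : PathOn A T a b := e ▸ h

theorem append (h : PathOn A S a b) (h' : PathOn A T c d) (hbc : A.Adj b c)
    (hd : ∀ z ∈ S, z ∉ T) : PathOn A (S ∪ T) a d := by
  induction h with
  | single a => exact (PathOn.cons hbc (by simpa using hd) h').of_eq (by ext; simp)
  | @cons S a b' c' hab ha h ih =>
    refine (PathOn.cons hab ?_ (ih hbc (by grind))).of_eq (by ext; simp)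
    grind

theorem symm (h : PathOn A S a b) : PathOn A S b a := by
  induction h with
  | single a => exact .single a
  | @cons S a b c hab ha h ih =>
    exact (ih.append (.single a) hab.symm (by grind)).of_eq (by ext; simp)

theorem snoc (h : PathOn A S a b) (hbc : A.Adj b c) (hc : c ∉ S) :
    PathOn A (insert c S) a c := (PathOn.cons hbc.symm hc h.symm).symm

theorem mono (h : PathOn A S a b) (hAB : ∀ a b, A.Adj a b → B.Adj a b) : PathOn B S a b := by
  induction h with
  | single a => exact .single a
  | cons hab ha h ih => exact .cons (hAB _ _ hab) ha ih

theorem split (h : PathOn A S a b) {u : V} (hu : u ∈ S) : u = a ∨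
    ∃ S₁ S₂ p, (∀ z ∈ S₁, z ∉ S₂) ∧ S₁ ∪ S₂ = S ∧ PathOn A S₁ a p ∧ A.Adj p u ∧
      PathOn A S₂ u b := by
  induction h with
  | single a => left; simpa using hu
  | @cons S a b c hab ha h ih =>
    rcases Finset.mem_insert.1 hu with rfl | hu
    · left; rfl
    right
    rcases ih hu with rfl | ⟨S₁, S₂, p, hd, he, h1, hp, h2⟩
    · exact ⟨{a}, S, a, by simpa using ha, by ext; simp, .single a, hab, h⟩
    · refine ⟨insert a S₁, S₂, p, by grind, by grind, .cons hab (by grind) h1, hp, h2⟩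

theorem single_eq (h : PathOn A S a a) : S = {a} := by
  cases h with
  | single => rfl
  | cons _ h1 h2 => exact absurd h2.right_mem h1

theorem toWalk (h : PathOn A S a b) :
    ∃ p : A.Walk a b, p.IsPath ∧ ∀ z, z ∈ p.support ↔ z ∈ S := by
  induction h with
  | single a => exact ⟨.nil, by simp, by simp⟩
  | cons hab ha h ih =>
    obtain ⟨p, hp, hs⟩ := ih
    refine ⟨.cons hab p, ?_, ?_⟩
    · rw [Walk.cons_isPath_iff]; exact ⟨hp, by rwa [hs]⟩
    · intro z; simp [hs]

theorem toLk (h : PathOn A S a b) {p q : V} (hp : A.Adj p a) (hq : A.Adj b q) : Lk A S p q := by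
  induction h generalizing p with
  | single a =>
    have := Lk.cons hp (by simp) (Lk.nil hq)
    simpa using this
  | cons hab ha h ih => exact .cons hp ha (ih hab hq)

theorem join {I : Finset V} {p q : V} (h : PathOn A S a p) (hl : Lk A I p q)
    (h' : PathOn A T q b) (h1 : ∀ z ∈ S, z ∉ I) (h2 : ∀ z ∈ S, z ∉ T) (h3 : ∀ z ∈ I, z ∉ T) :
    PathOn A (S ∪ I ∪ T) a b := by
  induction hl generalizing S with
  | nil hpq => exact (h.append h' hpq h2).of_eq (by simp)
  | cons hpx hx hl ih =>
    exact (ih (h.snoc hpx (by grind)) h' (by grind) (by grind) (by grind)).of_eq (by grind)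

end PathOn

namespace Lk
variable {A B : SimpleGraph V} {I : Finset V} {p q r : V}
theorem snoc (h : Lk A I p q) (hqr : A.Adj q r) (hq : q ∉ I) : Lk A (insert q I) p r := by
  induction h with
  | nil hpq => exact .cons hpq hq (.nil hqr)
  | @cons I p x q hpx hx h ih =>
    have := Lk.cons hpx (I := insert q I) (by grind) (ih hqr (by grind))
    rwa [Finset.insert_comm] at this
theorem symm (h : Lk A I p q) : Lk A I q p := by
  induction h with
  | nil hpq => exact .nil hpq.symm
  | cons hpx hx h ih => exact ih.snoc hpx.symm hx
theorem mono (h : Lk A I p q) (hAB : ∀ a b, A.Adj a b → B.Adj a b) : Lk B I p q := by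
  induction h with
  | nil h => exact .nil (hAB _ _ h)
  | cons hpx hx h ih => exact .cons (hAB _ _ hpx) hx ih
theorem cases' (h : Lk A I p q) : (I = ∅ ∧ A.Adj p q) ∨
    ∃ x J, I = insert x J ∧ x ∉ J ∧ A.Adj p x ∧ Lk A J x q := by
  cases h with
  | nil h => left; exact ⟨rfl, h⟩
  | cons hpx hx h => right; exact ⟨_, _, rfl, hx, hpx, h⟩
end Lk

theorem pathOn_of_walk {A : SimpleGraph V} {s : Set V} {a b : s} (w : (A.induce s).Walk a b) :
    ∃ S : Finset V, (∀ z ∈ S, z ∈ s) ∧ PathOn A S a b := by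
  induction w with
  | nil => exact ⟨{_}, by simp, .single _⟩
  | @cons a c b h w ih =>
    obtain ⟨S, hS, hp⟩ := ih
    by_cases ha : (a : V) ∈ S
    · rcases hp.split ha with e | ⟨S₁, S₂, p, hd, he, h1, hp, h2⟩
      · exact ⟨S, hS, e ▸ hp⟩
      · exact ⟨S₂, by grind, h2⟩
    · exact ⟨insert ↑a S, by grind, .cons (by simpa using h) ha hp⟩

theorem Cyc.rotate {A : SimpleGraph V} {S : Finset V} (h : Cyc A S) {u : V} (hu : u ∈ S) :
    ∃ b, A.Adj b u ∧ PathOn A S u b := by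
  obtain ⟨_, a, b, hab, hp⟩ := h
  rcases hp.split hu with rfl | ⟨S₁, S₂, p, hd, he, h1, hp, h2⟩
  · exact ⟨b, hab.symm, hp⟩
  · exact ⟨p, hp, (h2.append h1 hab.symm (by grind)).of_eq (by grind)⟩

theorem isHamiltonian_of_cyc [Fintype V] {G : SimpleGraph V} (h : Cyc G Finset.univ) :
    ∃ (v : V) (c : G.Walk v v), c.IsCycle ∧ ∀ u : V, u ∈ c.support := by
  obtain ⟨h3, a, b, hab, hp⟩ := h
  obtain ⟨p, hp, hs⟩ := hp.symm.toWalk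
  refine ⟨a, .cons hab p, ?_, by simp [hs]⟩
  rw [Walk.cons_isCycle_iff]
  refine ⟨hp, fun he => ?_⟩
  cases p with
  | nil => simp at hab
  | @cons _ c _ h q =>
    rw [Walk.cons_isPath_iff] at hp
    rw [Walk.edges_cons, List.mem_cons] at he
    rcases he with he | he
    · have : c = a := by
        rcases Sym2.eq_iff.1 he with ⟨h1, h2⟩ | ⟨h1, h2⟩
        · exact absurd h1 hab.ne
        · exact h1.symm
      subst this
      have := hp.1
      rw [Walk.isPath_iff_eq_nil] at this
      subst this
      have : (Finset.univ : Finset V) ⊆ {b, c} := by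
        intro z _; have := (hs z).2 (Finset.mem_univ z); simpa using this
      have := Finset.card_le_card this
      have := Finset.card_le_two (a := b) (b := c)
      omega
    · exact hp.2 (q.snd_mem_support_of_mem_edges he)
end helper

section helper
variable {V : Type} [DecidableEq V]

theorem PathOn.crossing {A : SimpleGraph V} {S : Finset V} {a b : V} (h : PathOn A S a b)
    (X Y : Finset V) :
    (∃ S₁ S₂ p q, (∀ z ∈ S₁, z ∉ S₂) ∧ S₁ ∪ S₂ = S ∧ PathOn A S₁ a p ∧ PathOn A S₂ q b ∧
      p ∈ Y ∧ q ∈ X) ∨ ((X ∩ S).erase a).card + ((Y ∩ S).erase b).card + 1 ≤ S.card := by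
  induction h with
  | single a =>
    right
    have h1 : (X ∩ {a}).erase a = ∅ := by ext; simp; tauto
    have h2 : (Y ∩ {a}).erase a = ∅ := by ext; simp; tauto
    simp [h1, h2]
  | @cons S a c b hac ha h ih =>
    rcases ih with ⟨S₁, S₂, p, q, hd, he, h1, h2, hp, hq⟩ | ih
    · exact .inl ⟨insert a S₁, S₂, p, q, by grind, by grind, .cons hac (by grind) h1, h2, hp, hq⟩
    by_cases hc : c ∈ X ∧ a ∈ Y
    · exact .inl ⟨{a}, S, a, c, by simpa using ha, by ext; simp, .single a, h, hc.2, hc.1⟩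
    right
    have hab : a ≠ b := fun e => ha (e ▸ h.right_mem)
    have e1 : (X ∩ insert a S).erase a = X ∩ S := by ext; simp; grind
    rw [e1, Finset.card_insert_of_notMem ha]
    by_cases hc' : c ∈ X
    · have haY : a ∉ Y := fun h => hc ⟨hc', h⟩
      have e2 : (Y ∩ insert a S).erase b = (Y ∩ S).erase b := by ext; simp; grind
      have := Finset.card_erase_of_mem (s := X ∩ S) (a := c) (by simp [hc', h.left_mem])
      rw [e2]; omega
    · have e3 : (X ∩ S).erase c = X ∩ S := by ext; simp; grind
      have e2 : (Y ∩ insert a S).erase b ⊆ insert a ((Y ∩ S).erase b) := by intro z; simp; grind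
      have := (Finset.card_le_card e2).trans (Finset.card_insert_le _ _)
      rw [e3] at ih; omega

theorem ore_step [Fintype V] {B : SimpleGraph V} {S : Finset V} {u v : V} (X Y : Finset V)
    (hX : ∀ z ∈ X, B.Adj u z) (hY : ∀ z ∈ Y, B.Adj v z)
    (hXY : Fintype.card V ≤ X.card + Y.card) (h : PathOn B S u v) (h3 : 3 ≤ S.card) :
    ∃ T, S ⊆ T ∧ Cyc B T := by
  by_cases hw : ∃ w, w ∉ S ∧ w ∈ X ∧ w ∈ Y
  · obtain ⟨w, hw, hx, hy⟩ := hw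
    refine ⟨insert w S, by simp, ?_, w, v, (hY w hy).symm, .cons (hX w hx).symm hw h⟩
    rw [Finset.card_insert_of_notMem hw]; omega
  push Not at hw
  rcases h.crossing X Y with ⟨S₁, S₂, p, q, hd, he, h1, h2, hp, hq⟩ | hc
  · exact ⟨S, le_rfl, h3, p, v, (hY p hp).symm, (h1.symm.append h2 (hX q hq) hd).of_eq he⟩
  exfalso
  have e1 : (X ∩ S).erase u = X ∩ S := Finset.erase_eq_of_notMem (fun h => by
    have := hX u (Finset.mem_inter.1 h).1; simp at this)
  have e2 : (Y ∩ S).erase v = Y ∩ S := Finset.erase_eq_of_notMem (fun h => by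
    have := hY v (Finset.mem_inter.1 h).1; simp at this)
  rw [e1, e2] at hc
  have hdj : Disjoint (X \ S) (Y \ S) := by
    rw [Finset.disjoint_left]; intro z; simp; intro a b c; exact absurd c (hw z b a)
  have h5 : ((X \ S) ∪ (Y \ S)).card ≤ Sᶜ.card := Finset.card_le_card (by intro z; simp; grind)
  rw [Finset.card_union_of_disjoint hdj, Finset.card_compl] at h5
  have := Finset.card_inter_add_card_sdiff X S
  have := Finset.card_inter_add_card_sdiff Y S
  have := Finset.card_le_univ S
  omega

theorem PathOn.drop_edge {B B' : SimpleGraph V} {u v : V}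
    (hB : ∀ a b, B'.Adj a b ↔ B.Adj a b ∨ (a = u ∧ b = v) ∨ (a = v ∧ b = u))
    {S : Finset V} {a b : V} (h : PathOn B' S a b) :
    PathOn B S a b ∨ ∃ S₁ S₂, (∀ z ∈ S₁, z ∉ S₂) ∧ S₁ ∪ S₂ = S ∧
      ((PathOn B S₁ a u ∧ PathOn B S₂ v b) ∨ (PathOn B S₁ a v ∧ PathOn B S₂ u b)) := by
  induction h with
  | single a => exact .inl (.single a)
  | @cons S a c b hac ha h ih =>
    rcases (hB _ _).1 hac with hac | ⟨rfl, rfl⟩ | ⟨rfl, rfl⟩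
    · rcases ih with ih | ⟨S₁, S₂, hd, he, hh⟩
      · exact .inl (.cons hac ha ih)
      · right
        refine ⟨insert a S₁, S₂, by grind, by grind, ?_⟩
        rcases hh with ⟨h1, h2⟩ | ⟨h1, h2⟩
        · exact .inl ⟨.cons hac (by grind) h1, h2⟩
        · exact .inr ⟨.cons hac (by grind) h1, h2⟩
    · rcases ih with ih | ⟨S₁, S₂, hd, he, hh⟩
      · exact .inr ⟨{a}, S, by simpa using ha, by ext; simp, .inl ⟨.single _, ih⟩⟩
      · exfalso
        rcases hh with ⟨h1, h2⟩ | ⟨h1, h2⟩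
        · have := h1.right_mem; grind
        · have := h2.left_mem; grind
    · rcases ih with ih | ⟨S₁, S₂, hd, he, hh⟩
      · exact .inr ⟨{a}, S, by simpa using ha, by ext; simp, .inr ⟨.single _, ih⟩⟩
      · exfalso
        rcases hh with ⟨h1, h2⟩ | ⟨h1, h2⟩
        · have := h2.left_mem; grind
        · have := h1.right_mem; grind

theorem cyc_drop_edge [Fintype V] {B B' : SimpleGraph V} {u v : V}
    (hB : ∀ a b, B'.Adj a b ↔ B.Adj a b ∨ (a = u ∧ b = v) ∨ (a = v ∧ b = u))
    (X Y : Finset V)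
    (hX : ∀ z ∈ X, B.Adj u z) (hY : ∀ z ∈ Y, B.Adj v z)
    (hXY : Fintype.card V ≤ X.card + Y.card) {S : Finset V} (h : Cyc B' S) :
    ∃ T, S ⊆ T ∧ Cyc B T := by
  obtain ⟨h3, a, b, hab, hp⟩ := h
  have key : ∀ {p q}, PathOn B S p q → (p = u ∧ q = v) ∨ (p = v ∧ q = u) →
      ∃ T, S ⊆ T ∧ Cyc B T := by
    rintro p q h (⟨rfl, rfl⟩ | ⟨rfl, rfl⟩)
    · exact ore_step X Y hX hY hXY h h3
    · exact ore_step X Y hX hY hXY h.symm h3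
  rcases hp.drop_edge hB with h | ⟨S₁, S₂, hd, he, hh⟩
  · rcases (hB _ _).1 hab with hab | hab
    · exact ⟨S, le_rfl, h3, a, b, hab, h⟩
    · exact key h hab
  · rcases (hB _ _).1 hab with hab | hab
    · rcases hh with ⟨h1, h2⟩ | ⟨h1, h2⟩
      · exact key ((h2.append h1 hab.symm (by grind)).of_eq (by grind)) (.inr ⟨rfl, rfl⟩)
      · exact key ((h2.append h1 hab.symm (by grind)).of_eq (by grind)) (.inl ⟨rfl, rfl⟩)
    · exfalso
      have aux : ∀ c d, (a = c ∧ b = d) → PathOn B S₁ a c → PathOn B S₂ d b → False := by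
        rintro _ _ ⟨rfl, rfl⟩ h1 h2
        have e1 := h1.single_eq
        have e2 := h2.single_eq
        subst e1 e2
        have := Finset.card_le_two (a := a) (b := b)
        rw [← he] at h3
        have : ({a} ∪ {b} : Finset V) = {a, b} := by ext; simp
        rw [this] at h3; omega
      have aux2 : ∀ c d, (a = d ∧ b = c) → PathOn B S₁ a c → PathOn B S₂ d b → False := by
        rintro _ _ ⟨rfl, rfl⟩ h1 h2
        exact hd _ h1.left_mem h2.left_mem
      rcases hh with ⟨h1, h2⟩ | ⟨h1, h2⟩ <;> rcases hab with hab | hab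
      · exact aux _ _ hab h1 h2
      · exact aux2 _ _ ⟨hab.1, hab.2⟩ h1 h2
      · exact aux2 _ _ ⟨hab.1, hab.2⟩ h1 h2
      · exact aux _ _ hab h1 h2

/-- the graph obtained by making all vertices of `H` adjacent -/
def heavyGraph (G : SimpleGraph V) (H : Set V) : SimpleGraph V where
  Adj a b := G.Adj a b ∨ (a ≠ b ∧ a ∈ H ∧ b ∈ H)
  symm := ⟨fun a b h => by
    rcases h with h | ⟨h1, h2, h3⟩
    · exact .inl h.symm
    · exact .inr ⟨h1.symm, h3, h2⟩⟩
  loopless := ⟨fun a h => by simp at h⟩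

theorem cyc_of_heavyGraph [Fintype V] {G : SimpleGraph V} [DecidableRel G.Adj] {H : Set V}
    (hH : ∀ v ∈ H, Fintype.card V ≤ 2 * G.degree v) {S : Finset V}
    (h : Cyc (heavyGraph G H) S) : ∃ T, S ⊆ T ∧ Cyc G T := by
  classical
  have main : ∀ E : Finset (V × V), (∀ e ∈ E, e.1 ∈ H ∧ e.2 ∈ H ∧ e.1 ≠ e.2) →
      ∀ (B : SimpleGraph V), (∀ a b, B.Adj a b ↔ G.Adj a b ∨ (a, b) ∈ E ∨ (b, a) ∈ E) →
      ∀ S, Cyc B S → ∃ T, S ⊆ T ∧ Cyc G T := by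
    intro E
    induction E using Finset.induction_on with
    | empty =>
      intro _ B hB S hS
      have : B = G := by ext a b; simp [hB]
      exact ⟨S, le_rfl, this ▸ hS⟩
    | @insert e E he ih =>
      intro hE B hB S hS
      let B₀ : SimpleGraph V :=
        { Adj := fun a b => G.Adj a b ∨ (a, b) ∈ E ∨ (b, a) ∈ E
          symm := ⟨fun a b h => by
            rcases h with h | h | h
            · exact .inl h.symm
            · exact .inr (.inr h)
            · exact .inr (.inl h)⟩
          loopless := ⟨fun a h => by
            rcases h with h | h | h
            · simp at h
            · exact (hE _ (Finset.mem_insert_of_mem h)).2.2 rfl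
            · exact (hE _ (Finset.mem_insert_of_mem h)).2.2 rfl⟩ }
      have h1 := hE e (Finset.mem_insert_self _ _)
      have d1 := hH _ h1.1
      have d2 := hH _ h1.2.1
      obtain ⟨T, hT, hc⟩ := cyc_drop_edge (B := B₀) (B' := B) (u := e.1) (v := e.2)
        (by
          intro a b
          obtain ⟨e1, e2⟩ := e
          rw [hB]; simp only [B₀, Finset.mem_insert, Prod.mk.injEq]; tauto)
        (G.neighborFinset e.1) (G.neighborFinset e.2)
        (by intro z hz; exact .inl (by simpa using hz))
        (by intro z hz; exact .inl (by simpa using hz))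
        (by simp only [card_neighborFinset_eq_degree]; omega) hS
      obtain ⟨T', hT', hc'⟩ := ih (fun e he => hE e (Finset.mem_insert_of_mem he)) B₀
        (fun a b => Iff.rfl) T hc
      exact ⟨T', hT.trans hT', hc'⟩
  refine main (Finset.univ.filter fun e : V × V => e.1 ∈ H ∧ e.2 ∈ H ∧ e.1 ≠ e.2)
    (by simp) (heavyGraph G H) ?_ S h
  intro a b
  simp only [heavyGraph, Finset.mem_filter, Finset.mem_univ, true_and]
  constructor
  · tauto
  · rintro (h | h | h)
    · exact .inl h
    · tauto
    · exact .inr ⟨h.2.2.symm, h.2.1, h.1⟩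

end helper

section helper
variable {V : Type} [DecidableEq V]

theorem exists_others (i : Fin 3) : ∃ j k : Fin 3, i ≠ j ∧ i ≠ k ∧ j ≠ k := by
  revert i; decide
theorem exists_third {i j : Fin 3} (h : i ≠ j) : ∃ k : Fin 3, i ≠ k ∧ j ≠ k := by
  revert i j; decide
theorem eq_of_others {i j k : Fin 3} (hij : i ≠ j) (hik : i ≠ k) (hjk : j ≠ k) (m : Fin 3) :
    m = i ∨ m = j ∨ m = k := by
  revert i j k m; decide

namespace Two
variable {A : SimpleGraph V} {D : Finset V} {d a b c x : V}
theorem swap (h : Two A D d a b c) : Two A D d a c b := by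
  obtain ⟨S, T, h1, h2, h3, h4⟩ := h
  exact ⟨S, T, h1, h2, h3, h4.symm⟩
theorem ext₁ (h : Two A D d a b c) (hx : x ∉ D) (hxa : A.Adj x a) :
    Two A (insert x D) d x b c := by
  obtain ⟨S, T, h1, h2, h3, h4⟩ := h
  exact ⟨insert x S, T, by grind, by grind, h3.snoc hxa.symm (by grind), h4⟩
theorem ext₂ (h : Two A D d a b c) (hx : x ∉ D) (hxb : A.Adj x b) :
    Two A (insert x D) d a x c := by
  obtain ⟨S, T, h1, h2, h3, h4⟩ := h
  exact ⟨S, insert x T, by grind, by grind, h3, .cons hxb (by grind) h4⟩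
theorem of_single (h : PathOn A D b c) (hx : x ∉ D) : Two A (insert x D) x x b c :=
  ⟨{x}, D, by simpa using hx, by ext; simp, .single x, h⟩
end Two

/-- A set `D` with three terminals `a`, `b`, `c`, richly connected by spanning paths. -/
structure Good (A : SimpleGraph V) (D : Finset V) (a b c : V) : Prop where
  pab : PathOn A D a b
  pac : PathOn A D a c
  pbc : PathOn A D b c
  ya : ∀ d ∈ D, d ≠ a → Two A D d b a c ∨ Two A D d c a b
  yb : ∀ d ∈ D, d ≠ b → Two A D d a b c ∨ Two A D d c a b
  yc : ∀ d ∈ D, d ≠ c → Two A D d a b c ∨ Two A D d b a c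

namespace Good
variable {A : SimpleGraph V} {D : Finset V} {a b c x p q : V}

theorem single (u : V) : Good A {u} u u u :=
  ⟨.single u, .single u, .single u, by simp, by simp, by simp⟩

theorem swap12 (h : Good A D a b c) : Good A D b a c where
  pab := h.pab.symm
  pac := h.pbc
  pbc := h.pac
  ya d hd hne := (h.yb d hd hne).imp id Two.swap
  yb d hd hne := (h.ya d hd hne).imp id Two.swap
  yc d hd hne := (h.yc d hd hne).symm

theorem swap23 (h : Good A D a b c) : Good A D a c b where
  pab := h.pac
  pac := h.pab
  pbc := h.pbc.symm
  ya d hd hne := (h.ya d hd hne).symm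
  yb d hd hne := (h.yc d hd hne).imp Two.swap id
  yc d hd hne := (h.yb d hd hne).imp Two.swap id

theorem extA (h : Good A D a b c) (hx : x ∉ D) (hxa : A.Adj x a) {d : V} (hd : d ∈ D)
    (hda : d ≠ a) (hxd : A.Adj x d) : Good A (insert x D) x b c where
  pab := .cons hxa hx h.pab
  pac := .cons hxa hx h.pac
  pbc := by
    rcases h.ya d hd hda with ⟨S, T, h1, h2, h3, h4⟩ | ⟨S, T, h1, h2, h3, h4⟩
    · exact ((h3.symm.snoc hxd.symm (by grind)).append h4 hxa (by grind)).of_eq (by grind)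
    · exact ((h4.symm.snoc hxa.symm (by grind)).append h3 hxd (by grind)).of_eq (by grind)
  ya e he hne := by
    have heD : e ∈ D := by grind
    by_cases hea : e = a
    · subst hea
      rcases h.ya d hd hda with ⟨S, T, h1, h2, h3, h4⟩ | ⟨S, T, h1, h2, h3, h4⟩
      · exact .inr ⟨T, insert x S, by grind, by grind, h4, .cons hxd (by grind) h3⟩
      · exact .inl ⟨T, insert x S, by grind, by grind, h4, .cons hxd (by grind) h3⟩
    · exact (h.ya e heD hea).imp (·.ext₂ hx hxa) (·.ext₂ hx hxa)
  yb e he hne := by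
    rcases Finset.mem_insert.1 he with rfl | he
    · exact .inl (Two.of_single h.pbc hx)
    · exact (h.yb e he hne).imp (·.ext₁ hx hxa) (·.ext₂ hx hxa)
  yc e he hne := by
    rcases Finset.mem_insert.1 he with rfl | he
    · exact .inl (Two.of_single h.pbc hx)
    · exact (h.yc e he hne).imp (·.ext₁ hx hxa) (·.ext₂ hx hxa)

theorem extC (h : Good A D a b c) (hp : p ∉ D) (hq : q ∉ D) (hpa : A.Adj p a) (hqb : A.Adj q b)
    (hpq : A.Adj p q) : Good A (insert p (insert q D)) p q c := by
  have hne : p ≠ q := hpq.ne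
  have hp' : p ∉ insert q D := by grind
  have hq' : q ∉ insert p D := by grind
  have pac' : PathOn A (insert p D) p c := .cons hpa hp h.pac
  have pbc' : PathOn A (insert q D) q c := .cons hqb hq h.pbc
  have hPab : PathOn A (insert p (insert q D)) p q := .cons hpa hp' (h.pab.snoc hqb.symm hq)
  have two : ∀ {e}, PathOn A D e c → Two A (insert p (insert q D)) e c p q := fun {e} he =>
    ⟨D, {p, q}, by grind, by grind, he, .cons hpq (by simpa using hne) (.single q)⟩
  have tp : Two A (insert p (insert q D)) p p q c := Two.of_single pbc' hp'
  have tq : Two A (insert p (insert q D)) q q p c := by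
    rw [Finset.insert_comm]; exact Two.of_single pac' hq'
  have Ta : ∀ {e}, Two A D e a b c → Two A (insert p (insert q D)) e p q c := fun h =>
    (h.ext₂ hq hqb).ext₁ hp' hpa
  have Tb : ∀ {e}, Two A D e b a c → Two A (insert p (insert q D)) e q p c := fun h =>
    (h.ext₁ hq hqb).ext₂ hp' hpa
  have Tc : ∀ {e}, Two A D e c a b → Two A (insert p (insert q D)) e c p q := fun h =>
    (h.swap.ext₂ hq hqb).swap.ext₂ hp' hpa
  refine ⟨hPab, .cons hpq hp' pbc', ?_, ?_, ?_, ?_⟩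
  · rw [Finset.insert_comm]; exact .cons hpq.symm hq' pac'
  · intro e he hne
    by_cases e1 : e = q
    · subst e1; exact .inl tq
    by_cases e2 : e = a
    · subst e2; exact .inr (two h.pac)
    exact (h.ya e (by grind) e2).imp Tb Tc
  · intro e he hne
    by_cases e1 : e = p
    · subst e1; exact .inl tp
    by_cases e2 : e = b
    · subst e2; exact .inr (two h.pbc)
    exact (h.yb e (by grind) e2).imp Ta Tc
  · intro e he hne
    by_cases e1 : e = p
    · subst e1; exact .inl tp
    by_cases e2 : e = q
    · subst e2; exact .inr tq
    exact (h.yc e (by grind) hne).imp Ta Tb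

theorem perm {t : Fin 3 → V} {i j k : Fin 3} (hij : i ≠ j) (hik : i ≠ k) (hjk : j ≠ k)
    (h : Good A D (t i) (t j) (t k)) (i' j' k' : Fin 3) (hij' : i' ≠ j') (hik' : i' ≠ k')
    (hjk' : j' ≠ k') : Good A D (t i') (t j') (t k') := by
  have : (i' = i ∧ j' = j ∧ k' = k) ∨ (i' = i ∧ j' = k ∧ k' = j) ∨ (i' = j ∧ j' = i ∧ k' = k) ∨
      (i' = j ∧ j' = k ∧ k' = i) ∨ (i' = k ∧ j' = i ∧ k' = j) ∨ (i' = k ∧ j' = j ∧ k' = i) := by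
    clear h
    have e1 := eq_of_others hij hik hjk i'
    have e2 := eq_of_others hij hik hjk j'
    have e3 := eq_of_others hij hik hjk k'
    grind
  rcases this with ⟨rfl, rfl, rfl⟩ | ⟨rfl, rfl, rfl⟩ | ⟨rfl, rfl, rfl⟩ | ⟨rfl, rfl, rfl⟩ |
    ⟨rfl, rfl, rfl⟩ | ⟨rfl, rfl, rfl⟩
  · exact h
  · exact h.swap23
  · exact h.swap12
  · exact h.swap12.swap23
  · exact h.swap23.swap12
  · exact h.swap12.swap23.swap12
end Good

theorem PathOn.close {A : SimpleGraph V} {S I : Finset V} {a b : V} (h : PathOn A S a b)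
    (hl : Lk A I b a) (hd : ∀ z ∈ S, z ∉ I) : ∃ c, A.Adj c a ∧ PathOn A (S ∪ I) a c := by
  suffices H : ∀ (I : Finset V) (p q : V), Lk A I p q → ∀ (S : Finset V), PathOn A S a p →
      (∀ z ∈ S, z ∉ I) → ∃ c, A.Adj c q ∧ PathOn A (S ∪ I) a c from H I b a hl S h hd
  intro I p q hl
  induction hl with
  | @nil p q hpq => intro S h hd; exact ⟨p, hpq, h.of_eq (by simp)⟩
  | @cons I p x q hpx hx hl ih =>
    intro S h hd
    obtain ⟨c, hc, hp⟩ := ih (insert x S) (h.snoc hpx (by grind)) (by grind)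
    exact ⟨c, hc, hp.of_eq (by grind)⟩

/-- Two good sets joined by three links, together spanning `W`. -/
structure Config (G A : SimpleGraph V) (W D D' : Finset V) (t t' : Fin 3 → V)
    (I : Fin 3 → Finset V) : Prop where
  good : ∀ i j k, i ≠ j → i ≠ k → j ≠ k → Good A D (t i) (t j) (t k)
  good' : ∀ i j k, i ≠ j → i ≠ k → j ≠ k → Good A D' (t' i) (t' j) (t' k)
  conn : (G.induce (D : Set V)).Connected
  conn' : (G.induce (D' : Set V)).Connected
  link : ∀ i, Lk G (I i) (t i) (t' i)
  dDD : ∀ z ∈ D, z ∉ D'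
  dDI : ∀ i, ∀ z ∈ D, z ∉ I i
  dDI' : ∀ i, ∀ z ∈ D', z ∉ I i
  dII : ∀ i j, i ≠ j → ∀ z ∈ I i, z ∉ I j
  hW : ∀ z, z ∈ W ↔ z ∈ D ∨ z ∈ D' ∨ ∃ i, z ∈ I i

namespace Config
variable {G A : SimpleGraph V} {W D D' : Finset V} {t t' : Fin 3 → V} {I : Fin 3 → Finset V}

theorem swap (h : Config G A W D D' t t' I) : Config G A W D' D t' t I where
  good := h.good'
  good' := h.good
  conn := h.conn'
  conn' := h.conn
  link i := (h.link i).symm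
  dDD z hz hz' := h.dDD z hz' hz
  dDI := h.dDI'
  dDI' := h.dDI
  dII := h.dII
  hW z := by rw [h.hW]; tauto

theorem hW3 (h : Config G A W D D' t t' I) {i j k : Fin 3} (hij : i ≠ j) (hik : i ≠ k)
    (hjk : j ≠ k) (z : V) : z ∈ W ↔ z ∈ D ∨ z ∈ D' ∨ z ∈ I i ∨ z ∈ I j ∨ z ∈ I k := by
  rw [h.hW]
  constructor
  · rintro (h | h | ⟨m, h⟩)
    · tauto
    · tauto
    · rcases eq_of_others hij hik hjk m with rfl | rfl | rfl <;> tauto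
  · rintro (h | h | h | h | h)
    · tauto
    · tauto
    all_goals exact .inr (.inr ⟨_, h⟩)

theorem nondeg (h : Config G A W D D' t t' I) (hA : ∀ a b, G.Adj a b → A.Adj a b)
    (hno : ∀ a b, A.Adj a b → ¬ PathOn A W a b) (i : Fin 3) : I i ≠ ∅ := by
  intro hi
  obtain ⟨j, k, hij, hik, hjk⟩ := exists_others i
  have g := (h.good i j k hij hik hjk).pbc.symm
  have g' := (h.good' i j k hij hik hjk).pbc
  have p := g.join ((h.link j).mono hA) g' (h.dDI j) h.dDD (fun z hz hz' => h.dDI' j z hz' hz)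
  have e1 := h.dDI k
  have e2 := h.dDI' k
  have e3 := h.dII j k hjk
  obtain ⟨c, hc, hp⟩ := p.close ((h.link k).mono hA).symm (by grind)
  refine hno _ _ hc.symm (hp.of_eq ?_)
  ext z
  rw [h.hW3 hij hik hjk, hi]
  simp; tauto

theorem conflict_aux (h : Config G A W D D' t t' I) (hA : ∀ a b, G.Adj a b → A.Adj a b)
    (hno : ∀ a b, A.Adj a b → ¬ PathOn A W a b) {i j k : Fin 3} (hij : i ≠ j) (hik : i ≠ k)
    (hjk : j ≠ k) {d d' : V} (hd : Two A D d (t i) (t j) (t k))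
    (hd' : Two A D' d' (t' j) (t' i) (t' k)) (hdd : A.Adj d d') : False := by
  obtain ⟨S, T, h1, h2, h3, h4⟩ := hd
  obtain ⟨S', T', h1', h2', h3', h4'⟩ := hd'
  have s1 : ∀ z ∈ S, z ∈ D := by grind
  have s2 : ∀ z ∈ T, z ∈ D := by grind
  have s3 : ∀ z ∈ S', z ∈ D' := by grind
  have s4 : ∀ z ∈ T', z ∈ D' := by grind
  have a0 := h.dDD
  have a1 := h.dDI i
  have a2 := h.dDI j
  have a3 := h.dDI k
  have b1 := h.dDI' i
  have b2 := h.dDI' j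
  have b3 := h.dDI' k
  have c1 := h.dII i j hij
  have c2 := h.dII i k hik
  have c3 := h.dII j k hjk
  have p1 := h3.join ((h.link i).mono hA) h4' (by grind) (by grind) (by grind)
  have p2 := p1.join ((h.link k).mono hA).symm h4.symm (by grind) (by grind) (by grind)
  have p3 := p2.join ((h.link j).mono hA) h3'.symm (by grind) (by grind) (by grind)
  refine hno _ _ hdd (p3.of_eq ?_)
  ext z
  rw [h.hW3 hij hik hjk, ← h2, ← h2']
  simp only [Finset.mem_union]; tauto

theorem typ (h : Config G A W D D' t t' I) {d : V} (hd : d ∈ D) {i : Fin 3} (hdi : d ≠ t i) :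
    ∃ j, j ≠ i ∧ ∀ k l, j ≠ k → j ≠ l → k ≠ l → Two A D d (t j) (t k) (t l) := by
  obtain ⟨j, k, hij, hik, hjk⟩ := exists_others i
  have key : ∀ {p q r : Fin 3}, p ≠ q → p ≠ r → q ≠ r → Two A D d (t p) (t q) (t r) →
      ∀ k l, p ≠ k → p ≠ l → k ≠ l → Two A D d (t p) (t k) (t l) := by
    intro p q r hpq hpr hqr hh k l h1 h2 h3
    have : (k = q ∧ l = r) ∨ (k = r ∧ l = q) := by
      rcases eq_of_others hpq hpr hqr k with rfl | rfl | rfl <;>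
      rcases eq_of_others hpq hpr hqr l with rfl | rfl | rfl <;> tauto
    rcases this with ⟨rfl, rfl⟩ | ⟨rfl, rfl⟩
    · exact hh
    · exact hh.swap
  rcases (h.good i j k hij hik hjk).ya d hd hdi with hh | hh
  · exact ⟨j, hij.symm, key hij.symm hjk hik hh⟩
  · exact ⟨k, hik.symm, key hik.symm hjk.symm hij hh⟩

theorem conflict (h : Config G A W D D' t t' I) (hA : ∀ a b, G.Adj a b → A.Adj a b)
    (hno : ∀ a b, A.Adj a b → ¬ PathOn A W a b) {d₁ d₂ e₁ e₂ : V} (h1 : d₁ ∈ D) (h2 : d₂ ∈ D)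
    (h12 : d₁ ≠ d₂) (he : e₁ ∈ D') (he2 : e₂ ∈ D') (he12 : e₁ ≠ e₂) (hd1 : A.Adj d₁ e₁)
    (hd2 : A.Adj d₂ e₁) : False := by
  have hex : ∃ i, e₁ ≠ t' i := by
    by_contra hcon
    push Not at hcon
    have g := (h.good' 0 1 2 (by decide) (by decide) (by decide)).pab
    rw [← hcon 0, ← hcon 1] at g
    have := g.single_eq
    rw [this] at he2
    exact he12 (Finset.mem_singleton.1 he2).symm
  obtain ⟨i, hi⟩ := hex
  obtain ⟨j, -, hj⟩ := h.swap.typ he hi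
  have key : ∀ d ∈ D, A.Adj d e₁ → d = t j := by
    intro d hd hde
    by_contra hne
    obtain ⟨m, hm, hmm⟩ := h.typ hd hne
    obtain ⟨k, hk1, hk2⟩ := exists_third hm
    exact h.conflict_aux hA hno hm hk1 hk2 (hmm j k hm hk1 hk2) (hj m k hm.symm hk2 hk1) hde
  exact h12 ((key _ h1 hd1).trans (key _ h2 hd2).symm)

theorem conn_insert {x y : V} (h : (G.induce (D : Set V)).Connected) (hy : y ∈ D)
    (hxy : G.Adj y x) : (G.induce ((insert x D : Finset V) : Set V)).Connected := by
  have h1 : (G.induce ({x} : Set V)).Connected := by simp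
  have := connected_induce_union h.preconnected h1.preconnected (Finset.mem_coe.2 hy) (Set.mem_singleton x) hxy
  convert this using 2
  all_goals (simp [Set.union_comm])

theorem extA (h : Config G A W D D' t t' I) (hA : ∀ a b, G.Adj a b → A.Adj a b)
    {i : Fin 3} {x d : V} {J : Finset V} (hI : I i = insert x J) (hx : x ∉ J)
    (htx : G.Adj (t i) x) (hl : Lk G J x (t' i)) (hd : d ∈ D) (hdi : d ≠ t i)
    (hxd : A.Adj x d) :
    Config G A W (insert x D) D' (Function.update t i x) t' (Function.update I i J) := by
  obtain ⟨j, k, hij, hik, hjk⟩ := exists_others i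
  have hxD : x ∉ D := fun hh => h.dDI i x hh (by simp [hI])
  have hxD' : x ∉ D' := fun hh => h.dDI' i x hh (by simp [hI])
  have hsub : ∀ m z, z ∈ Function.update I i J m → z ∈ I m ∧ z ≠ x := by
    intro m z hz
    by_cases hm : m = i
    · subst hm; simp at hz; rw [hI]; grind
    · rw [Function.update_of_ne hm] at hz
      refine ⟨hz, ?_⟩
      rintro rfl
      exact h.dII m i hm z hz (by simp [hI])
  refine ⟨?_, h.good', ?_, h.conn', ?_, ?_, ?_, ?_, ?_, ?_⟩
  · apply Good.perm hij hik hjk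
    simp only [Function.update_self, Function.update_of_ne hij.symm,
      Function.update_of_ne hik.symm]
    exact (h.good i j k hij hik hjk).extA hxD (hA _ _ htx.symm) hd hdi hxd
  · exact conn_insert h.conn (h.good i j k hij hik hjk).pab.left_mem htx
  · intro m
    by_cases hm : m = i
    · subst hm; simpa using hl
    · simpa [Function.update_of_ne hm] using h.link m
  · intro z hz; rcases Finset.mem_insert.1 hz with rfl | hz
    · exact hxD'
    · exact h.dDD z hz
  · intro m z hz hz'
    have := hsub m z hz'
    rcases Finset.mem_insert.1 hz with rfl | hz
    · exact this.2 rfl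
    · exact h.dDI m z hz this.1
  · intro m z hz hz'
    exact h.dDI' m z hz (hsub m z hz').1
  · intro m n hmn z hz hz'
    exact h.dII m n hmn z (hsub m z hz).1 (hsub n z hz').1
  · intro z
    rw [h.hW3 hij hik hjk]
    constructor
    · rw [hI]
      simp only [Finset.mem_insert]
      rintro (hz | hz | (hz | hz) | hz | hz)
      · tauto
      · tauto
      · tauto
      · exact .inr (.inr ⟨i, by simpa using hz⟩)
      · exact .inr (.inr ⟨j, by simpa [Function.update_of_ne hij.symm] using hz⟩)
      · exact .inr (.inr ⟨k, by simpa [Function.update_of_ne hik.symm] using hz⟩)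
    · rw [← h.hW3 hij hik hjk, h.hW]
      rintro (hz | hz | ⟨m, hz⟩)
      · rcases Finset.mem_insert.1 hz with rfl | hz
        · exact .inr (.inr ⟨i, by simp [hI]⟩)
        · tauto
      · tauto
      · exact .inr (.inr ⟨m, (hsub m z hz).1⟩)

theorem extC (h : Config G A W D D' t t' I) (hA : ∀ a b, G.Adj a b → A.Adj a b)
    {i j : Fin 3} (hij : i ≠ j) {x y : V} {J K : Finset V} (hI : I i = insert x J) (hx : x ∉ J)
    (htx : G.Adj (t i) x) (hl : Lk G J x (t' i)) (hI' : I j = insert y K) (hy : y ∉ K)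
    (hty : G.Adj (t j) y) (hl' : Lk G K y (t' j)) (hxy : A.Adj x y) :
    Config G A W (insert x (insert y D)) D' (Function.update (Function.update t j y) i x) t'
      (Function.update (Function.update I j K) i J) := by
  obtain ⟨k, hik, hjk⟩ := exists_third hij
  have hxD : x ∉ D := fun hh => h.dDI i x hh (by simp [hI])
  have hxD' : x ∉ D' := fun hh => h.dDI' i x hh (by simp [hI])
  have hyD : y ∉ D := fun hh => h.dDI j y hh (by simp [hI'])
  have hyD' : y ∉ D' := fun hh => h.dDI' j y hh (by simp [hI'])
  have ui : Function.update (Function.update I j K) i J i = J := by simp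
  have uj : Function.update (Function.update I j K) i J j = K := by
    simp [Function.update_of_ne hij.symm]
  have uk : Function.update (Function.update I j K) i J k = I k := by
    simp [Function.update_of_ne hik.symm, Function.update_of_ne hjk.symm]
  have hsub : ∀ m z, z ∈ Function.update (Function.update I j K) i J m →
      z ∈ I m ∧ z ≠ x ∧ z ≠ y := by
    intro m z hz
    have d1 := h.dII i j hij
    have d2 := h.dII i k hik
    have d3 := h.dII j k hjk
    rcases eq_of_others hij hik hjk m with rfl | rfl | rfl
    · rw [ui] at hz; grind
    · rw [uj] at hz; grind
    · rw [uk] at hz; grind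
  refine ⟨?_, h.good', ?_, h.conn', ?_, ?_, ?_, ?_, ?_, ?_⟩
  · apply Good.perm hij hik hjk
    simp only [Function.update_self, Function.update_of_ne hij.symm,
      Function.update_of_ne hik.symm, Function.update_of_ne hjk.symm]
    exact (h.good i j k hij hik hjk).extC hxD hyD (hA _ _ htx.symm) (hA _ _ hty.symm) hxy
  · have g := (h.good i j k hij hik hjk).pab
    exact conn_insert (conn_insert h.conn g.right_mem hty) (by simp [g.left_mem]) htx
  · intro m
    rcases eq_of_others hij hik hjk m with rfl | rfl | rfl
    · rw [ui]; simpa using hl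
    · rw [uj]; simpa [Function.update_of_ne hij.symm] using hl'
    · rw [uk]
      simpa [Function.update_of_ne hik.symm, Function.update_of_ne hjk.symm] using h.link m
  · intro z hz
    have := h.dDD z
    grind
  · intro m z hz hz'
    have := hsub m z hz'
    have := h.dDI m z
    grind
  · intro m z hz hz'
    exact h.dDI' m z hz (hsub m z hz').1
  · intro m n hmn z hz hz'
    exact h.dII m n hmn z (hsub m z hz).1 (hsub n z hz').1
  · intro z
    constructor
    · rw [h.hW3 hij hik hjk, hI, hI']
      simp only [Finset.mem_insert]
      rintro (hz | hz | (hz | hz) | (hz | hz) | hz)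
      · tauto
      · tauto
      · tauto
      · exact .inr (.inr ⟨i, by rwa [ui]⟩)
      · tauto
      · exact .inr (.inr ⟨j, by rwa [uj]⟩)
      · exact .inr (.inr ⟨k, by rwa [uk]⟩)
    · rw [h.hW]
      rintro (hz | hz | ⟨m, hz⟩)
      · rcases Finset.mem_insert.1 hz with rfl | hz
        · exact .inr (.inr ⟨i, by simp [hI]⟩)
        · rcases Finset.mem_insert.1 hz with rfl | hz
          · exact .inr (.inr ⟨j, by simp [hI']⟩)
          · tauto
      · tauto
      · exact .inr (.inr ⟨m, (hsub m z hz).1⟩)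

end Config
end helper

section helper
variable {V : Type} [DecidableEq V]

/-- An induced claw with centre `c`. -/
structure ClawIn (G : SimpleGraph V) (c p q r : V) : Prop where
  cp : G.Adj c p
  cq : G.Adj c q
  cr : G.Adj c r
  pq : p ≠ q
  pr : p ≠ r
  qr : q ≠ r
  npq : ¬ G.Adj p q
  npr : ¬ G.Adj p r
  nqr : ¬ G.Adj q r

/-- An induced net with triangle `p q r`. -/
structure NetIn (G : SimpleGraph V) (p q r p' q' r' : V) : Prop where
  pq : G.Adj p q
  pr : G.Adj p r
  qr : G.Adj q r
  pp : G.Adj p p'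
  qq : G.Adj q q'
  rr : G.Adj r r'
  n1 : ¬ G.Adj p q'
  n2 : ¬ G.Adj p r'
  n3 : ¬ G.Adj q p'
  n4 : ¬ G.Adj q r'
  n5 : ¬ G.Adj r p'
  n6 : ¬ G.Adj r q'
  n7 : ¬ G.Adj p' q'
  n8 : ¬ G.Adj p' r'
  n9 : ¬ G.Adj q' r'
  d1 : p ≠ q'
  d2 : p ≠ r'
  d3 : q ≠ p'
  d4 : q ≠ r'
  d5 : r ≠ p'
  d6 : r ≠ q'
  d7 : p' ≠ q'
  d8 : p' ≠ r'
  d9 : q' ≠ r'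

theorem exists_geodesic {G : SimpleGraph V} {s : Set V} (h : (G.induce s).Connected) {u v : V}
    (hu : u ∈ s) (hv : v ∈ s) : ∃ (M : ℕ) (p : ℕ → V), p 0 = u ∧ p M = v ∧ (∀ i, p i ∈ s) ∧
      (∀ i, i < M → G.Adj (p i) (p (i + 1))) ∧
      (∀ i j, i ≤ M → j ≤ M → G.Adj (p i) (p j) → i ≤ j + 1) ∧
      (∀ i j, i ≤ M → j ≤ M → p i = p j → i = j) := by
  obtain ⟨w, hw⟩ := h.exists_walk_length_eq_dist ⟨u, hu⟩ ⟨v, hv⟩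
  have hd : ∀ i, i ≤ w.length → (G.induce s).dist ⟨u, hu⟩ (w.getVert i) = i := by
    intro i hi
    have h1 := dist_le (w.take i)
    have h2 := dist_le (w.drop i)
    have h3 := h.dist_triangle (u := ⟨u, hu⟩) (v := w.getVert i) (w := ⟨v, hv⟩)
    rw [Walk.take_length] at h1
    rw [Walk.drop_length] at h2
    omega
  refine ⟨w.length, fun i => (w.getVert i : s), by simp, by simp, fun i => Subtype.coe_prop _,
    fun i hi => w.adj_getVert_succ hi, ?_, ?_⟩
  · intro i j hi hj hij
    have hij : (G.induce s).Adj (w.getVert j) (w.getVert i) := hij.symm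
    have h3 := h.dist_triangle (u := ⟨u, hu⟩) (v := w.getVert j) (w := w.getVert i)
    rw [hd i hi, hd j hj, dist_eq_one_iff_adj.2 hij] at h3
    exact h3
  · intro i j hi hj hij
    rw [← hd i hi, ← hd j hj, Subtype.ext hij]

theorem extraction {G : SimpleGraph V} {D : Finset V} (hD : (G.induce (D : Set V)).Connected)
    {x t : Fin 3 → V} (hxD : ∀ i, x i ∉ D) (htD : ∀ i, t i ∈ D) (hx : ∀ i j, i ≠ j → x i ≠ x j)
    (hn : ∀ i j, i ≠ j → ¬ G.Adj (x i) (x j)) (ht : ∀ i, G.Adj (x i) (t i))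
    (hu : ∀ i, ∀ d ∈ D, G.Adj (x i) d → d = t i) :
    (∃ c p q r, (∀ z ∈ ({p, q, r} : Finset V), z ∈ D ∨ ∃ i, z = x i) ∧ ClawIn G c p q r) ∨
    (∃ p q r p' q' r', (∀ z ∈ ({p, q, r, p', q', r'} : Finset V), z ∈ D ∨ ∃ i, z = x i) ∧
      NetIn G p q r p' q' r') := by
  have c1 := Config.conn_insert hD (htD 0) (ht 0).symm
  have c2 := Config.conn_insert c1 (Finset.mem_insert_of_mem (htD 1)) (ht 1).symm
  have c3 := Config.conn_insert hD (htD 2) (ht 2).symm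
  obtain ⟨M, p, p0, pM, ps, padj, pind, pinj⟩ := exists_geodesic c2 (u := x 0) (v := x 1)
    (by simp) (by simp)
  have x01 := hx 0 1 (by decide)
  have x02 := hx 0 2 (by decide)
  have x12 := hx 1 2 (by decide)
  have n01 := hn 0 1 (by decide)
  have n02 := hn 0 2 (by decide)
  have n12 := hn 1 2 (by decide)
  have hM : 2 ≤ M := by
    by_contra hM
    interval_cases M
    · exact x01 (p0.symm.trans pM)
    · exact n01 (by simpa [p0, pM] using padj 0 (by simp))
  have pD : ∀ i, 0 < i → i < M → p i ∈ D := by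
    intro i h0 h1
    have a1 : p i ≠ x 0 := fun h => by have := pinj i 0 (by omega) (by omega) (h.trans p0.symm); omega
    have a2 : p i ≠ x 1 := fun h => by have := pinj i M (by omega) (by omega) (h.trans pM.symm); omega
    have := ps i
    simp at this
    tauto
  have p1 : p 1 = t 0 := hu 0 _ (pD 1 (by omega) (by omega)) (p0 ▸ padj 0 (by omega))
  have pM1 : p (M - 1) = t 1 := by
    refine hu 1 _ (pD _ (by omega) (by omega)) ?_
    have := padj (M - 1) (by omega)
    rw [Nat.sub_add_cancel (by omega), pM] at this
    exact this.symm
  obtain ⟨N, f, f0, fN, fs, fadj, -, finj⟩ := exists_geodesic c3 (u := x 2) (v := p 1)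
    (by simp) (by have := pD 1 (by omega) (by omega); simp [this])
  have fs : ∀ i, f i = x 2 ∨ f i ∈ D := fun i => by simpa using fs i
  have hN : 0 < N := by
    rcases Nat.eq_zero_or_pos N with rfl | h
    · exact absurd (pD 1 (by omega) (by omega)) (by rw [← fN, f0]; exact hxD 2)
    · exact h
  let P : ℕ → Prop := fun k => ∃ i, 0 < i ∧ i < M ∧ G.Adj (f k) (p i)
  have hP : ∃ k, P k := ⟨N - 1, 1, by omega, by omega, by
    have := fadj (N - 1) (by omega)
    rwa [Nat.sub_add_cancel (by omega), fN] at this⟩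
  classical
  obtain ⟨m, ⟨a₀, ha₀⟩, hmin⟩ : ∃ m, P m ∧ ∀ k < m, ¬ P k :=
    ⟨Nat.find hP, Nat.find_spec hP, fun k hk => Nat.find_min hP hk⟩
  have mN : m ≤ N - 1 := by
    by_contra hh
    exact hmin (N - 1) (by omega) ⟨1, by omega, by omega, by
      have := fadj (N - 1) (by omega)
      rwa [Nat.sub_add_cancel (by omega), fN] at this⟩
  have notQ : ∀ k ≤ m, ∀ i, 0 < i → i < M → f k ≠ p i := by
    intro k hk i h0 h1 he
    rcases Nat.eq_zero_or_pos k with rfl | hk0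
    · exact hxD 2 (by rw [← f0, he]; exact pD i h0 h1)
    · refine hmin (k - 1) (by omega) ⟨i, h0, h1, ?_⟩
      have := fadj (k - 1) (by omega)
      rwa [Nat.sub_add_cancel (by omega), he] at this
  have ne0 : ∀ k, f k ≠ x 0 := fun k h => by
    rcases fs k with h' | h'
    · exact x02 (h.symm.trans h')
    · exact hxD 0 (h ▸ h')
  have ne1 : ∀ k, f k ≠ x 1 := fun k h => by
    rcases fs k with h' | h'
    · exact x12 (h.symm.trans h')
    · exact hxD 1 (h ▸ h')
  have na0 : ∀ k ≤ m, ¬ G.Adj (f k) (x 0) := fun k hk h => by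
    rcases fs k with h' | h'
    · exact n02 (h' ▸ h).symm
    · exact notQ k hk 1 (by omega) (by omega) (p1 ▸ hu 0 _ h' h.symm)
  have na1 : ∀ k ≤ m, ¬ G.Adj (f k) (x 1) := fun k hk h => by
    rcases fs k with h' | h'
    · exact n12 (h' ▸ h).symm
    · exact notQ k hk (M - 1) (by omega) (by omega) (pM1 ▸ hu 1 _ h' h.symm)
  have fne : ∀ k ≤ m, ∀ i ≤ M, f k ≠ p i := by
    intro k hk i hi
    rcases Nat.eq_zero_or_pos i with rfl | h0
    · rw [p0]; exact ne0 k
    · rcases hi.lt_or_eq with h1 | rfl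
      · exact notQ k hk i h0 h1
      · rw [pM]; exact ne1 k
  have fint : ∀ k ≤ m, ∀ i ≤ M, G.Adj (f k) (p i) → 0 < i ∧ i < M := by
    intro k hk i hi had
    constructor
    · rcases Nat.eq_zero_or_pos i with rfl | h0
      · exact absurd (p0 ▸ had) (na0 k hk)
      · exact h0
    · rcases hi.lt_or_eq with h1 | rfl
      · exact h1
      · exact absurd (pM ▸ had) (na1 k hk)
  have floc : ∀ k, f k ∈ D ∨ ∃ i, f k = x i := fun k => (fs k).symm.imp id fun h => ⟨2, h⟩
  have ploc : ∀ k, p k ∈ D ∨ ∃ i, p k = x i := fun k => by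
    have := ps k
    simp at this
    rcases this with h | h | h
    · exact .inr ⟨1, h⟩
    · exact .inr ⟨0, h⟩
    · exact .inl h
  have hQ : ∃ a, a ≤ M ∧ G.Adj (f m) (p a) := ⟨a₀, by omega, ha₀.2.2⟩
  obtain ⟨a, ⟨haM, haadj⟩, hamin⟩ : ∃ a, (a ≤ M ∧ G.Adj (f m) (p a)) ∧
      ∀ k < a, ¬ (k ≤ M ∧ G.Adj (f m) (p k)) :=
    ⟨Nat.find hQ, Nat.find_spec hQ, fun k hk => Nat.find_min hQ hk⟩
  obtain ⟨ha0, haM'⟩ := fint m le_rfl a haM haadj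
  have e1 : a - 1 + 1 = a := by omega
  have prev : G.Adj (p a) (p (a - 1)) := by
    have := padj (a - 1) (by omega)
    rw [e1] at this
    exact this.symm
  have nprev : ¬ G.Adj (f m) (p (a - 1)) := fun h => hamin (a - 1) (by omega) ⟨by omega, h⟩
  have nxt := padj a haM'
  have mpos : ∀ b ≤ M, b ≠ a → G.Adj (f m) (p b) → 0 < m := by
    intro b hb hba had
    rcases Nat.eq_zero_or_pos m with rfl | h
    · exfalso
      obtain ⟨hb0, hb1⟩ := fint 0 le_rfl b hb had
      rw [f0] at had haadj
      exact hba (pinj b a hb haM ((hu 2 _ (pD b hb0 hb1) had).trans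
        (hu 2 _ (pD a ha0 haM') haadj).symm))
    · exact h
  have prevf : 0 < m → G.Adj (f m) (f (m - 1)) := fun h => by
    have := fadj (m - 1) (by omega)
    rw [Nat.sub_add_cancel h] at this
    exact this.symm
  have nopre : 0 < m → ∀ i ≤ M, ¬ G.Adj (f (m - 1)) (p i) := fun h i hi had => by
    obtain ⟨b0, b1⟩ := fint (m - 1) (by omega) i hi had
    exact hmin (m - 1) (by omega) ⟨i, b0, b1, had⟩
  have nadj : ∀ i j, i ≤ M → j ≤ M → i + 1 < j → ¬ G.Adj (p i) (p j) := fun i j hi hj hij h => by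
    have := pind j i hj hi h.symm
    omega
  have pne : ∀ i j, i ≤ M → j ≤ M → i < j → p i ≠ p j := fun i j hi hj hij h => by
    have := pinj i j hi hj h
    omega
  by_cases hb : ∃ b, a + 2 ≤ b ∧ b ≤ M ∧ G.Adj (f m) (p b)
  · obtain ⟨b, hab, hbM, hb⟩ := hb
    have hm := mpos b hbM (by omega) hb
    refine .inl ⟨f m, p a, p b, f (m - 1), ?_, haadj, hb, prevf hm, pne a b haM hbM (by omega),
      (fne _ (by omega) _ haM).symm, (fne _ (by omega) _ hbM).symm, nadj a b haM hbM (by omega),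
      fun h => nopre hm _ haM h.symm, fun h => nopre hm _ hbM h.symm⟩
    intro z hz
    simp at hz
    rcases hz with rfl | rfl | rfl
    · exact ploc _
    · exact ploc _
    · exact floc _
  by_cases hb1 : G.Adj (f m) (p (a + 1))
  · have hm := mpos (a + 1) (by omega) (by omega) hb1
    obtain ⟨-, hM1⟩ := fint m le_rfl (a + 1) (by omega) hb1
    refine .inr ⟨p a, p (a + 1), f m, p (a - 1), p (a + 2), f (m - 1), ?_, ?_⟩
    · intro z hz
      simp at hz
      rcases hz with rfl | rfl | rfl | rfl | rfl | rfl
      · exact ploc _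
      · exact ploc _
      · exact floc _
      · exact ploc _
      · exact ploc _
      · exact floc _
    · exact {
        pq := nxt
        pr := haadj.symm
        qr := hb1.symm
        pp := prev
        qq := padj (a + 1) hM1
        rr := prevf hm
        n1 := nadj _ _ (by omega) (by omega) (by omega)
        n2 := fun h => nopre hm _ haM h.symm
        n3 := fun h => nadj (a - 1) (a + 1) (by omega) (by omega) (by omega) h.symm
        n4 := fun h => nopre hm _ (by omega) h.symm
        n5 := nprev
        n6 := fun h => hb ⟨a + 2, le_rfl, by omega, h⟩
        n7 := nadj _ _ (by omega) (by omega) (by omega)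
        n8 := fun h => nopre hm _ (by omega) h.symm
        n9 := fun h => nopre hm _ (by omega) h.symm
        d1 := pne _ _ (by omega) (by omega) (by omega)
        d2 := (fne _ (by omega) _ (by omega)).symm
        d3 := (pne _ _ (by omega) (by omega) (by omega)).symm
        d4 := (fne _ (by omega) _ (by omega)).symm
        d5 := fne _ (by omega) _ (by omega)
        d6 := fne _ (by omega) _ (by omega)
        d7 := pne _ _ (by omega) (by omega) (by omega)
        d8 := (fne _ (by omega) _ (by omega)).symm
        d9 := (fne _ (by omega) _ (by omega)).symm }
  · refine .inl ⟨p a, p (a - 1), p (a + 1), f m, ?_, prev, nxt, haadj.symm,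
      pne _ _ (by omega) (by omega) (by omega), (fne _ (by omega) _ (by omega)).symm,
      (fne _ (by omega) _ (by omega)).symm, nadj _ _ (by omega) (by omega) (by omega),
      fun h => nprev h.symm, fun h => hb1 h.symm⟩
    intro z hz
    simp at hz
    rcases hz with rfl | rfl | rfl
    · exact ploc _
    · exact ploc _
    · exact floc _

end helper

section helper
variable {V : Type} [DecidableEq V]

theorem dist_two_of {W : Type} {H : SimpleGraph W} {a b c : W} (h1 : H.Adj a b) (h2 : H.Adj b c)
    (h3 : a ≠ c) (h4 : ¬ H.Adj a c) : H.dist a c = 2 := by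
  have h5 : H.dist a c ≤ 2 := dist_le (.cons h1 (.cons h2 .nil))
  have h6 : H.dist a c ≠ 1 := fun h => h4 (dist_eq_one_iff_adj.1 h)
  have h7 : H.dist a c ≠ 0 := fun h =>
    h3 ((Walk.cons h1 (.cons h2 .nil) : H.Walk a c).reachable.dist_eq_zero_iff.1 h)
  omega

theorem ClawIn.heavy [Fintype V] {G : SimpleGraph V} [DecidableRel G.Adj] {c p q r : V}
    (h : ClawIn G c p q r) (hclaw : FHeavy G claw) :
    Fintype.card V ≤ 2 * max (G.degree p) (G.degree q) ∧
    Fintype.card V ≤ 2 * max (G.degree p) (G.degree r) ∧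
    Fintype.card V ≤ 2 * max (G.degree q) (G.degree r) := by
  obtain ⟨cp, cq, cr, pq, pr, qr, npq, npr, nqr⟩ := h
  have a1 := cp.ne
  have a2 := cq.ne
  have a3 := cr.ne
  have b1 := cp.symm
  have b2 := cq.symm
  have b3 := cr.symm
  rw [G.adj_comm] at npq npr nqr
  have c1 := npq
  have c2 := npr
  have c3 := nqr
  rw [G.adj_comm] at npq npr nqr
  let f : claw ↪g G := {
    toFun := ![c, p, q, r]
    inj' := by
      intro i j hij
      fin_cases i <;> fin_cases j <;> simp_all
    map_rel_iff' := by
      intro i j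
      change G.Adj (![c, p, q, r] i) (![c, p, q, r] j) ↔ claw.Adj i j
      clear hclaw
      fin_cases i <;> fin_cases j <;> simp_all [claw] }
  refine ⟨hclaw f 1 2 ?_, hclaw f 1 3 ?_, hclaw f 2 3 ?_⟩ <;>
  exact dist_two_of (b := 0) (by simp [claw]) (by simp [claw]) (by simp) (by simp [claw])

theorem NetIn.heavy [Fintype V] {G : SimpleGraph V} [DecidableRel G.Adj] {p q r p' q' r' : V}
    (h : NetIn G p q r p' q' r') (hN : FHeavy G netGraph) :
    Fintype.card V ≤ 2 * max (G.degree p') (G.degree q) ∧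
    Fintype.card V ≤ 2 * max (G.degree q') (G.degree r) ∧
    Fintype.card V ≤ 2 * max (G.degree r') (G.degree p) := by
  have hs : ∀ a b : V, G.Adj a b ↔ G.Adj b a := fun a b => G.adj_comm a b
  have hinj : Function.Injective ![p, q, r, p', q', r'] := by
    have := h.pq.ne
    have := h.pr.ne
    have := h.qr.ne
    have := h.pp.ne
    have := h.qq.ne
    have := h.rr.ne
    obtain ⟨⟩ := h
    intro i j hij
    fin_cases i <;> fin_cases j <;> simp_all
  let f : netGraph ↪g G := {
    toFun := ![p, q, r, p', q', r']
    inj' := hinj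
    map_rel_iff' := by
      intro i j
      change G.Adj (![p, q, r, p', q', r'] i) (![p, q, r, p', q', r'] j) ↔ netGraph.Adj i j
      fin_cases i <;> fin_cases j <;> simp [netGraph, h.pq, h.pr, h.qr, h.pp, h.qq, h.rr,
        h.n1, h.n2, h.n3, h.n4, h.n5, h.n6, h.n7, h.n8, h.n9, h.pq.symm, h.pr.symm, h.qr.symm,
        h.pp.symm, h.qq.symm, h.rr.symm, mt Adj.symm h.n1, mt Adj.symm h.n2, mt Adj.symm h.n3,
        mt Adj.symm h.n4, mt Adj.symm h.n5, mt Adj.symm h.n6, mt Adj.symm h.n7, mt Adj.symm h.n8,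
        mt Adj.symm h.n9] }
  refine ⟨hN f 3 1 ?_, hN f 4 2 ?_, hN f 5 0 ?_⟩
  · exact dist_two_of (b := 0) (by simp [netGraph]) (by simp [netGraph]) (by simp)
      (by simp [netGraph])
  · exact dist_two_of (b := 1) (by simp [netGraph]) (by simp [netGraph]) (by simp)
      (by simp [netGraph])
  · exact dist_two_of (b := 2) (by simp [netGraph]) (by simp [netGraph]) (by simp)
      (by simp [netGraph])

end helper

section helper
variable {V : Type} [DecidableEq V]

theorem Config.light_false [Fintype V] {G : SimpleGraph V} [DecidableRel G.Adj] {H : Set V}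
    (hH : ∀ v, v ∈ H ↔ Fintype.card V ≤ 2 * G.degree v) (hclaw : FHeavy G claw)
    (hN : FHeavy G netGraph) {W D D' : Finset V} {t t' : Fin 3 → V} {I : Fin 3 → Finset V}
    (h : Config G (heavyGraph G H) W D D' t t' I)
    (hno : ∀ a b, (heavyGraph G H).Adj a b → ¬ PathOn (heavyGraph G H) W a b)
    (hmax : ∀ D₁ t₁ I₁, Config G (heavyGraph G H) W D₁ D' t₁ t' I₁ → D₁.card ≤ D.card)
    (hl : ∀ a ∈ D, ∀ b ∈ D, a ∈ H → b ∈ H → a = b) : False := by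
  have hA : ∀ a b, G.Adj a b → (heavyGraph G H).Adj a b := fun a b h => .inl h
  have hx : ∀ i, ∃ x J, I i = insert x J ∧ x ∉ J ∧ G.Adj (t i) x ∧ Lk G J x (t' i) := by
    intro i
    rcases (h.link i).cases' with ⟨h1, -⟩ | h1
    · exact absurd h1 (h.nondeg hA hno i)
    · exact h1
  choose x J hI hxJ htx hlk using hx
  have hxD : ∀ i, x i ∉ D := fun i hd => h.dDI i _ hd (by simp [hI])
  have hmaxD : ∀ i, ∀ d ∈ D, (heavyGraph G H).Adj (x i) d → d = t i := by
    intro i d hd had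
    by_contra hne
    have := hmax _ _ _ (h.extA hA (hI i) (hxJ i) (htx i) (hlk i) hd hne had)
    rw [Finset.card_insert_of_notMem (hxD i)] at this
    omega
  have hmaxX : ∀ i j, i ≠ j → ¬ (heavyGraph G H).Adj (x i) (x j) := by
    intro i j hij had
    have := hmax _ _ _ (h.extC hA hij (hI i) (hxJ i) (htx i) (hlk i) (hI j) (hxJ j) (htx j)
      (hlk j) had)
    rw [Finset.card_insert_of_notMem (by simp [had.ne, hxD i]),
      Finset.card_insert_of_notMem (hxD j)] at this
    omega
  have htD : ∀ i, t i ∈ D := fun i => by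
    obtain ⟨j, k, hij, hik, hjk⟩ := exists_others i
    exact (h.good i j k hij hik hjk).pab.left_mem
  have hxx : ∀ i j, i ≠ j → x i ≠ x j := fun i j hij he =>
    h.dII i j hij (x i) (by simp [hI]) (by simp [hI, he])
  have hadj : ∀ z w, z ∈ H → w ∈ H → z ≠ w → (heavyGraph G H).Adj z w :=
    fun z w h1 h2 h3 => .inr ⟨h3, h1, h2⟩
  have kXX : ∀ z w, z ∈ H → w ∈ H → z ≠ w → (∃ i, z = x i) → (∃ i, w = x i) → False := by
    rintro _ _ h1 h2 h3 ⟨i, rfl⟩ ⟨j, rfl⟩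
    exact hmaxX i j (fun hij => h3 (by rw [hij])) (hadj _ _ h1 h2 h3)
  have kDD : ∀ z w, z ∈ H → w ∈ H → z ≠ w → z ∈ D → w ∈ D → False :=
    fun z w h1 h2 h3 h4 h5 => h3 (hl z h4 w h5 h1 h2)
  have kXD : ∀ z w, z ∈ H → w ∈ H → ¬ G.Adj z w → (∃ i, z = x i) → w ∈ D → False := by
    rintro _ w h1 h2 h3 ⟨i, rfl⟩ h5
    have := hmaxD i w h5 (hadj _ _ h1 h2 fun he => hxD i (he ▸ h5))
    exact h3 (this ▸ (htx i).symm)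
  have heavy_or : ∀ z w, Fintype.card V ≤ 2 * max (G.degree z) (G.degree w) → z ∈ H ∨ w ∈ H := by
    intro z w hzw
    rw [hH, hH]
    omega
  rcases extraction h.conn hxD htD hxx (fun i j hij had => hmaxX i j hij (hA _ _ had))
    (fun i => (htx i).symm) (fun i d hd had => hmaxD i d hd (hA _ _ had)) with
    ⟨c, p, q, r, hloc, hc⟩ | ⟨p, q, r, p', q', r', hloc, hn⟩
  · obtain ⟨e1, e2, e3⟩ := hc.heavy hclaw
    have lp := hloc p (by simp)
    have lq := hloc q (by simp)
    have lr := hloc r (by simp)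
    have key : ∀ z w, z ∈ H → w ∈ H → z ≠ w → ¬ G.Adj z w → (z ∈ D ∨ ∃ i, z = x i) →
        (w ∈ D ∨ ∃ i, w = x i) → False := by
      intro z w h1 h2 h3 h4 h5 h6
      rcases h5 with h5 | h5 <;> rcases h6 with h6 | h6
      · exact kDD z w h1 h2 h3 h5 h6
      · exact kXD w z h2 h1 (fun h => h4 h.symm) h6 h5
      · exact kXD z w h1 h2 h4 h5 h6
      · exact kXX z w h1 h2 h3 h5 h6
    have k1 := key p q
    have k2 := key p r
    have k3 := key q r
    have := hc.pq
    have := hc.pr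
    have := hc.qr
    have := hc.npq
    have := hc.npr
    have := hc.nqr
    rcases heavy_or _ _ e1 with e1 | e1 <;> rcases heavy_or _ _ e2 with e2 | e2 <;>
    rcases heavy_or _ _ e3 with e3 | e3 <;> grind
  · obtain ⟨e1, e2, e3⟩ := hn.heavy hN
    have key : ∀ a b c, a ∈ H → b ∈ H → c ∈ H → a ≠ b → a ≠ c → b ≠ c →
        a ∈ ({p, q, r, p', q', r'} : Finset V) → b ∈ ({p, q, r, p', q', r'} : Finset V) →
        c ∈ ({p, q, r, p', q', r'} : Finset V) → False := by
      intro a b c ha hb hc hab hac hbc la lb lc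
      have a1 := kDD a b ha hb hab
      have a2 := kDD a c ha hc hac
      have a3 := kDD b c hb hc hbc
      have b1 := kXX a b ha hb hab
      have b2 := kXX a c ha hc hac
      have b3 := kXX b c hb hc hbc
      rcases hloc a la with la | la <;> rcases hloc b lb with lb | lb <;>
      rcases hloc c lc with lc | lc <;>
      first
      | exact a1 la lb
      | exact a2 la lc
      | exact a3 lb lc
      | exact b1 la lb
      | exact b2 la lc
      | exact b3 lb lc
    have := hn.pq.ne
    have := hn.pr.ne
    have := hn.qr.ne
    have := hn.pp.ne
    have := hn.qq.ne
    have := hn.rr.ne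
    have := hn.d1
    have := hn.d2
    have := hn.d3
    have := hn.d4
    have := hn.d5
    have := hn.d6
    have := hn.d7
    have := hn.d8
    have := hn.d9
    rcases heavy_or _ _ e1 with e1 | e1 <;> rcases heavy_or _ _ e2 with e2 | e2 <;>
    rcases heavy_or _ _ e3 with e3 | e3 <;>
    refine key _ _ _ e1 e2 e3 ?_ ?_ ?_ (by simp) (by simp) (by simp) <;>
    first | assumption | (apply Ne.symm; assumption)

theorem Config.false [Fintype V] {G : SimpleGraph V} [DecidableRel G.Adj] {H : Set V}
    (hH : ∀ v, v ∈ H ↔ Fintype.card V ≤ 2 * G.degree v) (hclaw : FHeavy G claw)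
    (hN : FHeavy G netGraph) {W D D' : Finset V} {t t' : Fin 3 → V} {I : Fin 3 → Finset V}
    (h : Config G (heavyGraph G H) W D D' t t' I)
    (hno : ∀ a b, (heavyGraph G H).Adj a b → ¬ PathOn (heavyGraph G H) W a b) : False := by
  have hA : ∀ a b, G.Adj a b → (heavyGraph G H).Adj a b := fun a b h => .inl h
  suffices ∀ n (D D' : Finset V) (t t' : Fin 3 → V) (I : Fin 3 → Finset V),
      2 * Fintype.card V - (D.card + D'.card) = n →
      Config G (heavyGraph G H) W D D' t t' I → False from this _ D D' t t' I rfl h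
  clear h D D' t t' I
  intro n
  induction n using Nat.strong_induction_on with
  | _ n ih =>
  intro D D' t t' I hn h
  have step : ∀ (D₁ D₁' : Finset V) (t₁ t₁' : Fin 3 → V) (I₁ : Fin 3 → Finset V),
      Config G (heavyGraph G H) W D₁ D₁' t₁ t₁' I₁ → D₁.card + D₁'.card ≤ D.card + D'.card := by
    intro D₁ D₁' t₁ t₁' I₁ h₁
    by_contra hlt
    have c1 := D₁.card_le_univ
    have c2 := D₁'.card_le_univ
    exact ih _ (by omega) D₁ D₁' t₁ t₁' I₁ rfl h₁
  by_cases hl : ∀ a ∈ D, ∀ b ∈ D, a ∈ H → b ∈ H → a = b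
  · exact h.light_false hH hclaw hN hno
      (fun D₁ t₁ I₁ h₁ => by have := step _ _ _ _ _ h₁; omega) hl
  by_cases hl' : ∀ a ∈ D', ∀ b ∈ D', a ∈ H → b ∈ H → a = b
  · exact h.swap.light_false hH hclaw hN hno
      (fun D₁ t₁ I₁ h₁ => by have := step _ _ _ _ _ h₁; omega) hl'
  push Not at hl hl'
  obtain ⟨a, ha, b, hb, haH, hbH, hab⟩ := hl
  obtain ⟨a', ha', b', hb', haH', hbH', hab'⟩ := hl'
  exact h.conflict hA hno ha hb hab ha' hb' hab'
    (.inr ⟨fun e => h.dDD a ha (e ▸ ha'), haH, haH'⟩)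
    (.inr ⟨fun e => h.dDD b hb (e ▸ ha'), hbH, haH'⟩)

end helper

section helper
variable {V : Type} [DecidableEq V]

theorem PathOn.first_hit {A : SimpleGraph V} {T : Finset V} {y v : V} (h : PathOn A T y v)
    (S : Finset V) (hy : y ∉ S) (hv : v ∈ S) : ∃ I w v', PathOn A I y w ∧ A.Adj w v' ∧ v' ∈ S ∧
      v' ∈ T ∧ (∀ z ∈ I, z ∈ T) ∧ ∀ z ∈ I, z ∉ S := by
  induction h with
  | single a => exact absurd hv hy
  | @cons T a b c hab ha hp ih =>
    by_cases hb : b ∈ S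
    · exact ⟨{a}, a, b, .single a, hab, hb, by simp [hp.left_mem], by simp, by simpa using hy⟩
    · obtain ⟨I, w, v', h1, h2, h3, h4, h5, h6⟩ := ih hb hv
      exact ⟨insert a I, w, v', .cons hab (fun h => ha (h5 a h)) h1, h2, h3, by simp [h4],
        by grind, by grind⟩

theorem PathOn.toLk_erase {A : SimpleGraph V} {S : Finset V} {a p v : V} (h : PathOn A S a p)
    (hp : A.Adj p v) : Lk A (S.erase a) a v := by
  cases h with
  | single => simpa using Lk.nil hp
  | @cons T a b c hab ha hq =>
    rw [Finset.erase_insert ha]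
    exact hq.toLk hab hp

theorem exists_pathOn_avoid [Fintype V] {G : SimpleGraph V} (h2 : TwoConnected G) {a b v : V}
    (ha : a ≠ v) (hb : b ≠ v) : ∃ S, v ∉ S ∧ PathOn G S a b := by
  obtain ⟨w⟩ := (h2.2 v).preconnected ⟨a, ha⟩ ⟨b, hb⟩
  obtain ⟨S, hS, hp⟩ := pathOn_of_walk w
  exact ⟨S, fun hv => hS v hv rfl, hp⟩

theorem exists_ne_ne [Fintype V] {G : SimpleGraph V} (h2 : TwoConnected G) (v w : V) :
    ∃ z, z ≠ v ∧ z ≠ w := by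
  by_contra hcon
  push Not at hcon
  have h3 : (Finset.univ : Finset V) ⊆ {v, w} := by
    intro z _
    by_cases hz : z = v
    · simp [hz]
    · simp [hcon z hz]
  have h4 := Finset.card_le_card h3
  have h5 : ({v, w} : Finset V).card ≤ 2 := Finset.card_le_two
  have h6 := h2.1
  rw [Finset.card_univ] at h4
  omega

theorem exists_nbr [Fintype V] {G : SimpleGraph V} (h2 : TwoConnected G) {v w : V}
    (hvw : v ≠ w) : ∃ a, G.Adj v a ∧ a ≠ w := by
  obtain ⟨z, hz1, hz2⟩ := exists_ne_ne h2 v w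
  obtain ⟨S, hS, hp⟩ := exists_pathOn_avoid h2 hvw hz2
  cases hp with
  | single => exact absurd rfl hz1
  | @cons T a b c hab ha hq => exact ⟨b, hab, fun e => hS (by simp [← e, hq.left_mem])⟩

theorem exists_cyc [Fintype V] {G : SimpleGraph V} (h2 : TwoConnected G) : ∃ S, Cyc G S := by
  have h3 := h2.1
  obtain ⟨v⟩ : Nonempty V := Fintype.card_pos_iff.1 (by omega)
  obtain ⟨w, hw, -⟩ := exists_ne_ne h2 v v
  obtain ⟨a, hva, -⟩ := exists_nbr h2 hw.symm
  obtain ⟨b, hvb, hba⟩ := exists_nbr h2 hva.ne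
  obtain ⟨S, hS, hp⟩ := exists_pathOn_avoid h2 hva.ne' hvb.ne'
  refine ⟨insert v S, ?_, v, b, hvb, .cons hva hS hp⟩
  have : ({a, b} : Finset V) ⊆ S := by
    intro z hz
    have := hp.left_mem
    have := hp.right_mem
    grind
  have := Finset.card_le_card this
  rw [Finset.card_pair hba.symm] at this
  rw [Finset.card_insert_of_notMem hS]
  omega

theorem conn_single {G : SimpleGraph V} (u : V) :
    (G.induce (({u} : Finset V) : Set V)).Connected := by
  rw [Finset.coe_singleton]
  simp

theorem exists_config [Fintype V] {G A : SimpleGraph V} (h2 : TwoConnected G) {S : Finset V}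
    (hS : Cyc G S) (hne : S ≠ Finset.univ) : ∃ W D D' t t' I, S.card < W.card ∧
      Config G A W D D' t t' I := by
  obtain ⟨y₀, hy₀⟩ : ∃ y, y ∉ S := by
    by_contra hcon
    push Not at hcon
    exact hne (by ext z; simp [hcon z])
  have other : ∀ u, ∃ v ∈ S, v ≠ u := fun u => by
    apply Finset.exists_mem_ne
    have := hS.1
    omega
  obtain ⟨u₀, hu₀, -⟩ := other y₀
  obtain ⟨w₀, hw1, hw2⟩ := exists_ne_ne h2 y₀ u₀
  obtain ⟨T, -, hT⟩ := exists_pathOn_avoid h2 hw1.symm hw2.symm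
  obtain ⟨I₀, y, u, hI0, hyu, hu, -, -, hI0S⟩ := hT.first_hit S hy₀ hu₀
  have hy : y ∉ S := hI0S y hI0.right_mem
  obtain ⟨v₀, hv₀, hv₀u⟩ := other u
  obtain ⟨T', huT, hT'⟩ := exists_pathOn_avoid h2 hyu.ne hv₀u
  obtain ⟨I₁, w, v, hI1, hwv, hv, hvT, hI1T, hI1S⟩ := hT'.first_hit S hy hv₀
  have huv : v ≠ u := fun e => huT (e ▸ hvT)
  obtain ⟨b, hbu, hp⟩ := hS.rotate hu
  rcases hp.split hv with e | ⟨S₁, S₂, p, hd, he, q1, hpv, q2⟩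
  · exact absurd e huv
  have m1 := q1.left_mem
  have m2 := q2.left_mem
  have l0 : Lk G I₁ u v := hI1.toLk hyu.symm hwv
  have l1 : Lk G (S₁.erase u) u v := q1.toLk_erase hpv
  have l2 : Lk G (S₂.erase v) u v := (q2.toLk_erase hbu).symm
  refine ⟨S ∪ I₁, {u}, {v}, fun _ => u, fun _ => v, ![I₁, S₁.erase u, S₂.erase v], ?_, ?_⟩
  · apply Finset.card_lt_card
    refine ⟨Finset.subset_union_left, fun hsub => hy (hsub (Finset.mem_union_right _ hI1.left_mem))⟩
  · refine ⟨fun _ _ _ _ _ _ => .single u, fun _ _ _ _ _ _ => .single v,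
      conn_single u, conn_single v, ?_,
      by simpa using huv.symm, ?_, ?_, ?_, ?_⟩
    · intro i
      fin_cases i
      · exact l0
      · exact l1
      · exact l2
    · intro i z hz
      fin_cases i <;> simp <;> grind
    · intro i z hz
      fin_cases i <;> simp <;> grind
    · intro i j hij z hz hz'
      fin_cases i <;> fin_cases j <;> simp at hij hz hz' <;> grind
    · intro z
      simp only [Fin.exists_fin_succ, Matrix.cons_val_zero, Matrix.cons_val_succ]
      simp
      grind

end helper

theorem hamiltonian_of_claw_net_f_heavy {V : Type} [Fintype V] (G : SimpleGraph V)
    [DecidableRel G.Adj] (h2 : TwoConnected G)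
    (hclaw : FHeavy G claw) (hN : FHeavy G netGraph) :
    IsHamiltonianGraph G := by
  classical
  obtain ⟨S₀, hS₀⟩ := exists_cyc h2
  obtain ⟨S, hS, hmax⟩ := Finset.exists_max_image (Finset.univ.filter fun S => Cyc G S)
    Finset.card ⟨S₀, by simpa using hS₀⟩
  simp only [Finset.mem_filter, Finset.mem_univ, true_and] at hS hmax
  by_cases hne : S = Finset.univ
  · subst hne
    exact isHamiltonian_of_cyc hS
  · exfalso
    let H : Set V := {v | Fintype.card V ≤ 2 * G.degree v}
    obtain ⟨W, D, D', t, t', I, hW, hc⟩ := exists_config (A := heavyGraph G H) h2 hS hne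
    refine hc.false (H := H) (fun v => Iff.rfl) hclaw hN ?_
    intro a b hab hp
    have h3 := hS.1
    obtain ⟨T, hWT, hT⟩ := cyc_of_heavyGraph (H := H) (fun v hv => hv)
      (⟨by omega, a, b, hab, hp⟩ : Cyc (heavyGraph G H) W)
    have h4 := Finset.card_le_card hWT
    have h5 := hmax T hT
    omega
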